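/- (Cut and paste, special boundary conditions.) Let ℓ ≥ 1, N > 2ℓ+2, and 0 ≤ c₁, c_N ≤ ℓ, and set Ñ = N − (ℓ+2), so Ñ > ℓ. For every f ≥ ℓ, the cohomology H_Q^f of the unit-coupling supercharge of the M_ℓ model on the open chain of N sites with special boundary conditions s = (c₁, c_N) is isomorphic to the cohomology H_Q^{f−ℓ} of the M_ℓ model on the open chain of Ñ sites with special boundary conditions s' = (c₁, c_{Ñ}) = (c₁, c_N); in particular their dimensions are equal. -/

import Mathlib

attribute [local instance 10] Classical.propDecidable

noncomputable section

/-- A configuration of `N` sites: `true` = occupied, `false` = empty. -/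
abbrev Config (N : ℕ) := Fin N → Bool

/-- Extension of a configuration to all of `ℕ`, by empty sites outside the chain. -/
def extc {N : ℕ} (σ : Config N) (t : ℕ) : Bool :=
  if h : t < N then σ ⟨t, h⟩ else false

/-- The fermion number: the number of occupied sites. -/
def fermions {N : ℕ} (σ : Config N) : ℕ :=
  (Finset.univ.filter fun i => σ i = true).card

/-- Allowed configurations of the open chain of `N` sites with exclusion parameter `ℓ`
and special boundary conditions `(c₁, cN)`: no cluster is longer than `ℓ`, the cluster
containing the first site (if occupied) has length at most `c₁`, and the cluster
containing the last site (if occupied) has length at most `cN`. -/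
def OpenOK (N ℓ c₁ cN : ℕ) (σ : Config N) : Prop :=
  (∀ a : ℕ, ¬ ∀ k ≤ ℓ, extc σ (a + k) = true) ∧
  (¬ (c₁ + 1 ≤ N ∧ ∀ k ≤ c₁, extc σ k = true)) ∧
  (¬ (cN + 1 ≤ N ∧ ∀ k ≤ cN, extc σ (N - 1 - k) = true))

/-- Cyclic shift of a site of the closed chain by `k` steps. -/
def cyc {N : ℕ} (i : Fin N) (k : ℕ) : Fin N :=
  ⟨(i.1 + k) % N, Nat.mod_lt _ i.pos⟩

/-- Allowed configurations of the closed chain of `N` sites with periodic boundary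
conditions: the chain is not fully occupied and no maximal cyclic run of occupied
sites is longer than `ℓ`. -/
def PerOK (N ℓ : ℕ) (σ : Config N) : Prop :=
  ∀ i : Fin N, ∃ k ≤ ℓ, σ (cyc i k) = false

/-- The fermionic sign `(-1)^{#{j < i : σ j = 1}}`. -/
def sgn {N : ℕ} (σ : Config N) (i : Fin N) : ℂ :=
  (-1 : ℂ) ^ ((Finset.univ.filter fun j => j < i ∧ σ j = true).card)

/-- The Hilbert space `V_N`: complex functions on allowed configurations. -/
abbrev AState (N : ℕ) (OK : Config N → Prop) := {σ : Config N // OK σ} → ℂ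

/-- Matrix of the supercharge with amplitudes `A`, with particle insertion
restricted to the sublattice `S`: the entry `(τ, σ)` is the amplitude (with fermionic
sign) for obtaining `τ` from `σ` by occupying an empty site of `S`. -/
def QmatA (N : ℕ) (OK : Config N → Prop) (S : Fin N → Prop)
    (A : Config N → Fin N → ℂ) :
    Matrix {σ : Config N // OK σ} {σ : Config N // OK σ} ℂ := fun τ σ =>
  ∑ i : Fin N,
    if S i ∧ σ.1 i = false ∧ τ.1 = Function.update σ.1 i true
    then A σ.1 i * sgn σ.1 i else 0

/-- The supercharge with amplitudes `A` restricted to the sublattice `S`, as a linear map. -/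
def QopA (N : ℕ) (OK : Config N → Prop) (S : Fin N → Prop)
    (A : Config N → Fin N → ℂ) : AState N OK →ₗ[ℂ] AState N OK :=
  (QmatA N OK S A).mulVecLin

/-- The unit-coupling supercharge restricted to the sublattice `S`. -/
def Qop (N : ℕ) (OK : Config N → Prop) (S : Fin N → Prop) :
    AState N OK →ₗ[ℂ] AState N OK :=
  QopA N OK S fun _ _ => 1

/-- The subspace `V_{N,f}` of states supported on configurations with fermion number `f`. -/
def gradeV (N : ℕ) (OK : Config N → Prop) (f : ℕ) :
    Submodule ℂ (AState N OK) where
  carrier := {ψ | ∀ σ, fermions σ.1 ≠ f → ψ σ = 0}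
  add_mem' := by
    intro a b ha hb σ h
    show a σ + b σ = 0
    rw [ha σ h, hb σ h, add_zero]
  zero_mem' := by intro σ h; rfl
  smul_mem' := by
    intro c a ha σ h
    show c * a σ = 0
    rw [ha σ h, mul_zero]

/-- The cocycles at gradeV `f`: `ker Q ∩ V_{N,f}` (for the supercharge restricted to `S`). -/
def cocycles (N : ℕ) (OK : Config N → Prop) (S : Fin N → Prop) (f : ℕ) :
    Submodule ℂ (AState N OK) :=
  LinearMap.ker (Qop N OK S) ⊓ gradeV N OK f

/-- The coboundaries at gradeV `f`: `Q (V_{N,f-1})` (for the supercharge restricted to `S`). -/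
def cobounds (N : ℕ) (OK : Config N → Prop) (S : Fin N → Prop) (f : ℕ) :
    Submodule ℂ (AState N OK) :=
  (gradeV N OK (f - 1)).map (Qop N OK S)

/-- The cohomology `H_Q^f = ker (Q : V_{N,f} → V_{N,f+1}) / Q (V_{N,f-1})`. -/
abbrev CohSpace (N : ℕ) (OK : Config N → Prop) (S : Fin N → Prop) (f : ℕ) :=
  cocycles N OK S f ⧸ ((cobounds N OK S f).comap (cocycles N OK S f).subtype)

/-- The dimension of `H_Q^f`. -/
def cohDim (N : ℕ) (OK : Config N → Prop) (S : Fin N → Prop) (f : ℕ) : ℕ :=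
  Module.finrank ℂ (CohSpace N OK S f)

/-- The cohomology class represented by a cocycle. -/
def cohClass (N : ℕ) (OK : Config N → Prop) (S : Fin N → Prop) (f : ℕ)
    (ψ : AState N OK) (h : ψ ∈ cocycles N OK S f) : CohSpace N OK S f :=
  Submodule.Quotient.mk ⟨ψ, h⟩

open Finset Function


section Supercharge

variable {N : ℕ} {OK : Config N → Prop}

/-- Extension of a state by zero to all configurations. -/
def extz (ψ : AState N OK) (σ : Config N) : ℂ :=
  if h : OK σ then ψ ⟨σ, h⟩ else 0

lemma extz_of_ok (ψ : AState N OK) {σ : Config N} (h : OK σ) : extz ψ σ = ψ ⟨σ, h⟩ :=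
  dif_pos h

lemma extz_of_not_ok (ψ : AState N OK) {σ : Config N} (h : ¬ OK σ) : extz ψ σ = 0 :=
  dif_neg h

lemma ok_of_extz_ne_zero {ψ : AState N OK} {σ : Config N} (h : extz ψ σ ≠ 0) : OK σ := by
  by_contra hσ
  exact h (extz_of_not_ok ψ hσ)

lemma update_false_of_update_true {σ τ : Config N} {i : Fin N} (hσ : σ i = false)
    (h : τ = update σ i true) : σ = update τ i false := by
  subst h
  rw [update_idem, ← hσ, update_eq_self]

lemma sgn_update_self (σ : Config N) (i : Fin N) (b : Bool) :
    sgn (update σ i b) i = sgn σ i := by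
  unfold sgn
  congr 2
  ext j
  simp only [mem_filter, mem_univ, true_and]
  refine and_congr_right fun h => ?_
  rw [update_of_ne h.ne]

/-- The supercharge evaluated on an allowed configuration, as a sum over particle removals. -/
lemma Qop_apply (ψ : AState N OK) (τ : {σ : Config N // OK σ}) :
    Qop N OK (fun _ => True) ψ τ =
      ∑ j, if τ.1 j = true then sgn τ.1 j * extz ψ (update τ.1 j false) else 0 := by
  simp only [Qop, QopA, Matrix.mulVecLin_apply, Matrix.mulVec, dotProduct, QmatA, true_and,
    one_mul, sum_mul]
  rw [sum_comm]
  refine sum_congr rfl fun i _ => ?_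
  have hzero : ∀ σ : {σ : Config N // OK σ}, σ.1 ≠ update τ.1 i false →
      (if σ.1 i = false ∧ τ.1 = update σ.1 i true then sgn σ.1 i else 0) * ψ σ = 0 := by
    intro σ hσ
    rw [if_neg, zero_mul]
    exact fun h => hσ (update_false_of_update_true h.1 h.2)
  split_ifs with hτ
  · by_cases hOK : OK (update τ.1 i false)
    · rw [sum_eq_single ⟨_, hOK⟩ (fun σ _ hσ => hzero σ fun h => hσ (Subtype.ext h)) (by simp),
        extz_of_ok ψ hOK, if_pos, sgn_update_self]
      refine ⟨update_self .., ?_⟩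
      rw [update_idem, ← hτ, update_eq_self]
    · rw [extz_of_not_ok ψ hOK, mul_zero]
      exact sum_eq_zero fun σ _ => hzero σ fun h => hOK (h ▸ σ.2)
  · refine sum_eq_zero fun σ _ => ?_
    rw [if_neg, zero_mul]
    rintro ⟨-, h⟩
    exact hτ (by rw [h, update_self])

lemma sgn_mul_self (σ : Config N) (i : Fin N) : sgn σ i * sgn σ i = 1 := by
  rw [sgn, ← mul_pow]
  simp

lemma sgn_update_false {σ : Config N} {k : Fin N} (hk : σ k = true) (i : Fin N) :
    sgn (update σ k false) i = if k < i then -sgn σ i else sgn σ i := by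
  unfold sgn
  split_ifs with h
  · have : (univ.filter fun j => j < i ∧ σ j = true) =
        insert k (univ.filter fun j => j < i ∧ update σ k false j = true) := by
      ext j
      by_cases hj : j = k
      · subst hj; simp [h, hk]
      · simp [hj]
    rw [this, card_insert_of_notMem (by simp), pow_succ]
    simp
  · congr 2
    ext j
    by_cases hj : j = k
    · subst hj; simp [h]
    · simp [hj]

/-- Removing two particles in either order gives opposite signs. -/
lemma sgn_antisymm {σ : Config N} {i j : Fin N} (hij : i ≠ j) (hi : σ i = true)
    (hj : σ j = true) :
    sgn σ i * sgn (update σ i false) j = -(sgn σ j * sgn (update σ j false) i) := by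
  rw [sgn_update_false hi, sgn_update_false hj]
  rcases lt_or_gt_of_ne hij with h | h
  · rw [if_pos h, if_neg h.not_gt]; ring
  · rw [if_neg h.not_gt, if_pos h]; ring

lemma sgn_antisymm' {σ : Config N} {i j : Fin N} (hij : i ≠ j) (hi : σ i = false)
    (hj : σ j = true) :
    sgn σ i * sgn (update σ i true) j = -(sgn σ j * sgn (update σ j false) i) := by
  have h := sgn_antisymm (σ := update σ i true) hij (update_self ..)
    (by rw [update_of_ne hij.symm, hj])
  rw [sgn_update_self, update_idem, ← hi, update_eq_self, hi,
    update_comm hij, sgn_update_self] at h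
  have h1 := sgn_mul_self σ i
  have h2 := sgn_mul_self σ j
  have h3 := sgn_mul_self (update σ i true) j
  linear_combination (sgn σ j * sgn (update σ i true) j) * h -
    (sgn σ i * sgn (update σ i true) j) * h2 -
    (sgn σ j * sgn (update σ j false) i) * h3

lemma update_false_le (σ : Config N) (i : Fin N) : update σ i false ≤ σ :=
  update_le_self_iff.2 (Bool.false_le _)

lemma le_update_true (σ : Config N) (i : Fin N) : σ ≤ update σ i true :=
  le_update_self_iff.2 (Bool.le_true _)

lemma Qop_Qop (hOK : {σ | OK σ}.OrdConnected) (ψ : AState N OK) :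
    Qop N OK (fun _ => True) (Qop N OK (fun _ => True) ψ) = 0 := by
  funext τ
  set F : Fin N → Fin N → ℂ := fun j k =>
    if τ.1 j = true ∧ τ.1 k = true ∧ j ≠ k then
      sgn τ.1 j * sgn (update τ.1 j false) k *
        extz ψ (update (update τ.1 j false) k false) else 0 with hF
  have hsum : Qop N OK (fun _ => True) (Qop N OK (fun _ => True) ψ) τ = ∑ j, ∑ k, F j k := by
    rw [Qop_apply]
    refine sum_congr rfl fun j _ => ?_
    split_ifs with hj
    · by_cases h : OK (update τ.1 j false)
      · rw [extz_of_ok _ h, Qop_apply, mul_sum]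
        refine sum_congr rfl fun k _ => ?_
        by_cases hk : j = k
        · subst hk; simp [hF]
        · simp [hF, hj, hk, Ne.symm hk, mul_assoc]
      · rw [extz_of_not_ok _ h, mul_zero]
        symm
        refine sum_eq_zero fun k _ => ?_
        simp only [hF]
        split_ifs with hk
        · rw [extz_of_not_ok, mul_zero]
          exact fun h' => h (hOK.out h' τ.2 ⟨update_false_le _ _, update_false_le _ _⟩)
        · rfl
    · simp [hF, hj]
  have hanti : ∀ j k, F j k = -F k j := by
    intro j k
    simp only [hF]
    by_cases h : τ.1 j = true ∧ τ.1 k = true ∧ j ≠ k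
    · rw [if_pos h, if_pos ⟨h.2.1, h.1, h.2.2.symm⟩, sgn_antisymm h.2.2 h.1 h.2.1,
        update_comm h.2.2]
      ring
    · rw [if_neg h, if_neg fun h' => h ⟨h'.2.1, h'.1, h'.2.2.symm⟩, neg_zero]
  have hneg : ∑ j, ∑ k, F j k = -∑ j, ∑ k, F j k := by
    conv_lhs => rw [sum_comm]
    simp only [← sum_neg_distrib]
    exact sum_congr rfl fun j _ => sum_congr rfl fun k _ => hanti k j
  rw [hsum]
  exact self_eq_neg.1 hneg

lemma fermions_update_false {σ : Config N} {i : Fin N} (hi : σ i = true) :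
    fermions (update σ i false) + 1 = fermions σ := by
  unfold fermions
  have : (univ.filter fun j => σ j = true) =
      insert i (univ.filter fun j => update σ i false j = true) := by
    ext j
    by_cases hj : j = i
    · subst hj; simp [hi]
    · simp [hj]
  rw [this, card_insert_of_notMem (by simp)]

variable (N OK) in
/-- The states of grade `f - 1` (only the zero state for `f = 0`). -/
def lowerV (f : ℕ) : Submodule ℂ (AState N OK) where
  carrier := {ψ | ∀ σ, fermions σ.1 + 1 ≠ f → ψ σ = 0}
  add_mem' := by
    intro a b ha hb σ h
    rw [Pi.add_apply, ha σ h, hb σ h, add_zero]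
  zero_mem' := fun _ _ => rfl
  smul_mem' := by
    intro c a ha σ h
    rw [Pi.smul_apply, ha σ h, smul_zero]

lemma Qop_mem_gradeV {f : ℕ} {ψ : AState N OK} (hψ : ψ ∈ lowerV N OK f) :
    Qop N OK (fun _ => True) ψ ∈ gradeV N OK f := by
  intro τ hτ
  rw [Qop_apply]
  refine sum_eq_zero fun j _ => ?_
  split_ifs with hj
  · by_cases h : OK (update τ.1 j false)
    · rw [extz_of_ok _ h, hψ _ (by rwa [fermions_update_false hj]), mul_zero]
    · rw [extz_of_not_ok _ h, mul_zero]
  · rfl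

lemma lowerV_succ (f : ℕ) : lowerV N OK (f + 1) = gradeV N OK f := by
  ext ψ
  exact forall_congr' fun σ => by rw [Ne, add_left_inj]

/-- In every grade, a homogeneous state is a coboundary iff it is the image of a state one
grade below. -/
lemma mem_cobounds_iff {f : ℕ} {φ : AState N OK} (hφ : φ ∈ gradeV N OK f) :
    φ ∈ cobounds N OK (fun _ => True) f ↔
      ∃ χ ∈ lowerV N OK f, Qop N OK (fun _ => True) χ = φ := by
  cases f with
  | succ f => rw [lowerV_succ]; rfl
  | zero =>
    constructor
    · rintro ⟨χ, hχ, rfl⟩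
      refine ⟨0, zero_mem _, ?_⟩
      rw [map_zero]
      funext τ
      by_cases h : fermions τ.1 = 0
      · have h1 : Qop N OK (fun _ => True) χ ∈ gradeV N OK 1 :=
          Qop_mem_gradeV ((lowerV_succ 0).symm ▸ hχ)
        exact (h1 τ (by omega)).symm
      · exact (hφ τ h).symm
    · rintro ⟨χ, hχ, rfl⟩
      exact ⟨χ, fun σ _ => hχ σ (by omega), rfl⟩

end Supercharge

/-- A grade-compatible injective chain map onto a deformation retract induces an isomorphism
in cohomology. -/
theorem cohSpace_equiv_of_retract {N N' : ℕ} {OK : Config N → Prop} {OK' : Config N' → Prop}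
    {f f' : ℕ} (J : AState N' OK' →ₗ[ℂ] AState N OK) (h : AState N OK →ₗ[ℂ] AState N OK)
    (hQQ : ∀ ψ, Qop N OK (fun _ => True) (Qop N OK (fun _ => True) ψ) = 0)
    (hJ : Injective J)
    (hQJ : ∀ φ, Qop N OK (fun _ => True) (J φ) = J (Qop N' OK' (fun _ => True) φ))
    (hgrade : ∀ φ, J φ ∈ gradeV N OK f ↔ φ ∈ gradeV N' OK' f')
    (hlower : ∀ φ, J φ ∈ lowerV N OK f ↔ φ ∈ lowerV N' OK' f')
    (h_grade : ∀ ψ ∈ gradeV N OK f, h ψ ∈ lowerV N OK f)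
    (h_lower : ∀ χ ∈ lowerV N OK f, Qop N OK (fun _ => True) (h χ) ∈ lowerV N OK f)
    (hhJ : ∀ φ, h (J φ) = 0)
    (hret : ∀ ψ, ∃ φ,
      J φ = ψ - Qop N OK (fun _ => True) (h ψ) - h (Qop N OK (fun _ => True) ψ)) :
    Nonempty (CohSpace N OK (fun _ => True) f ≃ₗ[ℂ] CohSpace N' OK' (fun _ => True) f') := by
  have hmap : ∀ φ ∈ cocycles N' OK' (fun _ => True) f', J φ ∈ cocycles N OK (fun _ => True) f :=
    fun φ hφ => ⟨by
      have h0 : Qop N' OK' (fun _ => True) φ = 0 := hφ.1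
      show Qop N OK (fun _ => True) (J φ) = 0
      rw [hQJ, h0, map_zero], (hgrade φ).2 hφ.2⟩
  let Jc := J.restrict hmap
  have hcomap : ∀ φ : cocycles N' OK' (fun _ => True) f',
      J φ ∈ cobounds N OK (fun _ => True) f ↔ φ.1 ∈ cobounds N' OK' (fun _ => True) f' := by
    intro φ
    rw [mem_cobounds_iff (hmap _ φ.2).2, mem_cobounds_iff φ.2.2]
    constructor
    · rintro ⟨χ, hχ, hχφ⟩
      obtain ⟨χ', hχ'⟩ := hret χ
      rw [hχφ, hhJ, sub_zero] at hχ'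
      refine ⟨χ', (hlower _).1 (hχ' ▸ sub_mem hχ (h_lower χ hχ)), hJ ?_⟩
      rw [← hQJ, hχ', map_sub, hQQ, sub_zero, hχφ]
    · rintro ⟨χ, hχ, hχφ⟩
      exact ⟨J χ, (hlower _).2 hχ, by rw [hQJ, hχφ]⟩
  let G := Submodule.mapQ
    ((cobounds N' OK' (fun _ => True) f').comap (cocycles N' OK' (fun _ => True) f').subtype)
    ((cobounds N OK (fun _ => True) f).comap (cocycles N OK (fun _ => True) f).subtype)
    Jc (fun φ hφ => (hcomap φ).2 hφ)
  refine ⟨(LinearEquiv.ofBijective G ⟨?_, ?_⟩).symm⟩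
  · rw [injective_iff_map_eq_zero]
    intro x hx
    obtain ⟨φ, rfl⟩ := Submodule.Quotient.mk_surjective _ x
    have hφ : Jc φ ∈ (cobounds N OK (fun _ => True) f).comap
      (cocycles N OK (fun _ => True) f).subtype := (Submodule.Quotient.mk_eq_zero _).1 hx
    exact (Submodule.Quotient.mk_eq_zero _).2 ((hcomap φ).1 hφ)
  · intro y
    obtain ⟨ψ, rfl⟩ := Submodule.Quotient.mk_surjective _ y
    have hψ : Qop N OK (fun _ => True) ψ.1 = 0 := ψ.2.1
    obtain ⟨φ, hφ⟩ := hret ψ.1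
    rw [hψ, map_zero, sub_zero] at hφ
    have hhψ := h_grade _ ψ.2.2
    have hφf : φ ∈ gradeV N' OK' f' :=
      (hgrade φ).1 (hφ ▸ sub_mem ψ.2.2 (Qop_mem_gradeV hhψ))
    have hφQ : Qop N' OK' (fun _ => True) φ = 0 := by
      apply hJ
      rw [← hQJ, hφ, map_sub, hψ, hQQ, sub_zero, map_zero]
    refine ⟨Submodule.Quotient.mk ⟨φ, hφQ, hφf⟩, ?_⟩
    refine (Submodule.Quotient.eq _).2 ?_
    show J φ - ψ.1 ∈ cobounds N OK (fun _ => True) f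
    rw [hφ, sub_sub_cancel_left]
    exact neg_mem ((mem_cobounds_iff (Qop_mem_gradeV hhψ)).2 ⟨_, hhψ, rfl⟩)

section Toggle

variable {N : ℕ} {OK : Config N → Prop}

variable (OK) in
/-- The allowed configurations in which site `i` is empty and cannot be occupied. -/
def Blocked (i : Fin N) (σ : Config N) : Prop :=
  OK σ ∧ σ i = false ∧ ¬ OK (update σ i true)

lemma Blocked.of_le (hOK : {σ | OK σ}.OrdConnected) {i : Fin N} {σ τ : Config N}
    (hσ : Blocked OK i σ) (hτ : OK τ) (hστ : σ ≤ τ) : Blocked OK i τ := by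
  have hle : ∀ ρ : Config N, OK ρ → σ ≤ ρ → ρ i = true → False := fun ρ hρ hσρ hi =>
    hσ.2.2 (hOK.out hσ.1 hρ ⟨le_update_true _ _, update_le_iff.2 ⟨hi.ge, fun j _ => hσρ j⟩⟩)
  refine ⟨hτ, ?_, fun h => hle _ h (hστ.trans (le_update_true _ _)) (update_self ..)⟩
  by_contra h
  exact hle τ hτ hστ (by simpa using h)

variable (OK) in
/-- The operator removing a particle from site `i`. -/
def annihilate (i : Fin N) : AState N OK →ₗ[ℂ] AState N OK where
  toFun ψ σ := if σ.1 i = false then sgn σ.1 i * extz ψ (update σ.1 i true) else 0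
  map_add' a b := by
    funext σ
    by_cases h : OK (update σ.1 i true)
    · simp only [Pi.add_apply, extz_of_ok _ h]
      split_ifs <;> ring
    · simp [extz_of_not_ok _ h]
  map_smul' c a := by
    funext σ
    by_cases h : OK (update σ.1 i true)
    · simp only [Pi.smul_apply, extz_of_ok _ h, smul_eq_mul, RingHom.id_apply]
      split_ifs <;> ring
    · simp [extz_of_not_ok _ h]

lemma annihilate_apply (i : Fin N) (ψ : AState N OK) (σ : {σ : Config N // OK σ}) :
    annihilate OK i ψ σ =
      if σ.1 i = false then sgn σ.1 i * extz ψ (update σ.1 i true) else 0 := rfl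

variable (OK) in
/-- Extension by zero of the states on blocked configurations. -/
def blockedIncl (i : Fin N) : AState N (Blocked OK i) →ₗ[ℂ] AState N OK where
  toFun φ σ := extz φ σ.1
  map_add' a b := by
    funext σ
    by_cases h : Blocked OK i σ.1
    · simp [extz_of_ok _ h]
    · simp [extz_of_not_ok _ h]
  map_smul' c a := by
    funext σ
    by_cases h : Blocked OK i σ.1
    · simp [extz_of_ok _ h]
    · simp [extz_of_not_ok _ h]

lemma extz_blockedIncl (i : Fin N) (φ : AState N (Blocked OK i)) (σ : Config N) :
    extz (blockedIncl OK i φ) σ = extz φ σ := by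
  by_cases h : OK σ
  · exact extz_of_ok _ h
  · rw [extz_of_not_ok _ h, extz_of_not_ok _ fun h' => h h'.1]

lemma fermions_update_true {σ : Config N} {i : Fin N} (hi : σ i = false) :
    fermions (update σ i true) = fermions σ + 1 := by
  rw [← fermions_update_false (update_self i true σ), update_idem, ← hi, update_eq_self]

lemma annihilate_grade {P : ℕ → Prop} (i : Fin N) {ψ : AState N OK}
    (hψ : ∀ σ, ¬ P (fermions σ.1) → ψ σ = 0) (σ : {σ : Config N // OK σ})
    (hσ : ¬ P (fermions σ.1 + 1)) : annihilate OK i ψ σ = 0 := by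
  rw [annihilate_apply]
  split_ifs with h
  · by_cases h' : OK (update σ.1 i true)
    · rw [extz_of_ok _ h', hψ _ (by rwa [fermions_update_true h]), mul_zero]
    · rw [extz_of_not_ok _ h', mul_zero]
  · rfl

/-- Off the blocked configurations, `Q` and the annihilation operator satisfy the canonical
anticommutation relation. -/
lemma Qop_annihilate_add {i : Fin N} (hi : ∀ σ, OK σ → OK (update σ i false))
    (ψ : AState N OK) (τ : {σ : Config N // OK σ}) (hτ : ¬ Blocked OK i τ.1) :
    Qop N OK (fun _ => True) (annihilate OK i ψ) τ +
      annihilate OK i (Qop N OK (fun _ => True) ψ) τ = ψ τ := by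
  rw [Qop_apply, annihilate_apply]
  cases h : τ.1 i with
  | true =>
    rw [if_neg (by simp), add_zero, sum_eq_single i]
    · rw [if_pos h, extz_of_ok _ (hi _ τ.2), annihilate_apply, if_pos (update_self ..),
        sgn_update_self, update_idem, ← h, update_eq_self, extz_of_ok _ τ.2, ← mul_assoc,
        sgn_mul_self, one_mul]
    · intro j _ hj
      split_ifs
      · by_cases hOK : OK (update τ.1 j false)
        · rw [extz_of_ok _ hOK, annihilate_apply, if_neg, mul_zero]
          simp [update_of_ne hj.symm, h]
        · rw [extz_of_not_ok _ hOK, mul_zero]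
      · rfl
    · simp
  | false =>
    have hOK : OK (update τ.1 i true) := by
      by_contra hn
      exact hτ ⟨τ.2, h, hn⟩
    rw [if_pos rfl, extz_of_ok _ hOK, Qop_apply, mul_sum, ← sum_add_distrib,
      sum_eq_single i]
    · rw [if_neg (by simp [h]), if_pos (update_self ..), sgn_update_self, update_idem, ← h,
        update_eq_self, extz_of_ok _ τ.2, ← mul_assoc, sgn_mul_self, one_mul, zero_add]
    · intro j _ hj
      simp only [update_of_ne hj]
      cases hjτ : τ.1 j with
      | false => simp
      | true =>
        simp only [if_true]
        rw [update_comm hj.symm]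
        by_cases hOKj : OK (update τ.1 j false)
        · rw [extz_of_ok _ hOKj, annihilate_apply,
            if_pos ((update_of_ne hj.symm ..).trans h), ← mul_assoc, ← mul_assoc,
            sgn_antisymm' hj.symm h hjτ]
          ring
        · rw [extz_of_not_ok _ hOKj, extz_of_not_ok, mul_zero, mul_zero, mul_zero, add_zero]
          intro hn
          have := hi _ hn
          rw [update_idem, ← h, update_comm hj, update_eq_self] at this
          exact hOKj (by simpa [h] using this)
    · simp

/-- Restricting to the blocked configurations of a removable site does not change the
cohomology. -/
theorem cohSpace_equiv_blocked (hOK : {σ | OK σ}.OrdConnected) {i : Fin N}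
    (hi : ∀ σ, OK σ → OK (update σ i false)) (f : ℕ) :
    Nonempty (CohSpace N OK (fun _ => True) f ≃ₗ[ℂ]
      CohSpace N (Blocked OK i) (fun _ => True) f) := by
  have hval : ∀ (φ : AState N (Blocked OK i)) (P : ℕ → Prop),
      (∀ σ, P (fermions σ.1) → blockedIncl OK i φ σ = 0) ↔
        ∀ σ, P (fermions σ.1) → φ σ = 0 := by
    intro φ P
    constructor
    · intro h σ hσ
      have := h ⟨σ.1, σ.2.1⟩ hσ
      rwa [← extz_of_ok (blockedIncl OK i φ) σ.2.1, extz_blockedIncl, extz_of_ok _ σ.2] at this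
    · intro h σ hσ
      by_cases hB : Blocked OK i σ.1
      · exact (extz_of_ok _ hB).trans (h ⟨_, hB⟩ hσ)
      · exact extz_of_not_ok _ hB
  have hcomm : ∀ φ, Qop N OK (fun _ => True) (blockedIncl OK i φ) =
      blockedIncl OK i (Qop N (Blocked OK i) (fun _ => True) φ) := by
    intro φ
    funext τ
    rw [Qop_apply]
    simp only [extz_blockedIncl]
    by_cases hB : Blocked OK i τ.1
    · exact ((extz_of_ok _ hB).trans (Qop_apply _ _)).symm
    · refine Eq.trans (sum_eq_zero fun j _ => ?_) (extz_of_not_ok _ hB).symm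
      rw [extz_of_not_ok, mul_zero, ite_self]
      exact fun h => hB (h.of_le hOK τ.2 (update_false_le _ _))
  have hann : ∀ φ, annihilate OK i (blockedIncl OK i φ) = 0 := by
    intro φ
    funext σ
    rw [annihilate_apply, extz_blockedIncl, extz_of_not_ok, mul_zero, ite_self]
    · rfl
    · intro h
      simpa using h.2.1
  refine cohSpace_equiv_of_retract (blockedIncl OK i) (annihilate OK i) (Qop_Qop hOK) ?_ hcomm
    (fun φ => hval φ fun n => n ≠ f) (fun φ => hval φ fun n => n + 1 ≠ f) ?_ ?_ hann ?_
  · rw [injective_iff_map_eq_zero]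
    intro φ hφ
    funext σ
    exact (hval φ fun _ => True).1 (fun τ _ => by rw [hφ]; rfl) σ trivial
  · exact fun ψ hψ => annihilate_grade (P := fun n => n = f) i hψ
  · intro χ hχ
    cases f with
    | zero =>
      have : χ = 0 := funext fun σ => hχ σ (by omega)
      simp [this]
    | succ f =>
      rw [lowerV_succ] at hχ ⊢
      exact Qop_mem_gradeV (annihilate_grade (P := fun n => n = f) i hχ)
  · intro ψ
    set ρ := ψ - Qop N OK (fun _ => True) (annihilate OK i ψ) -
      annihilate OK i (Qop N OK (fun _ => True) ψ) with hρ
    refine ⟨fun σ => ρ ⟨σ.1, σ.2.1⟩, funext fun τ => ?_⟩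
    by_cases hB : Blocked OK i τ.1
    · exact extz_of_ok (fun σ => ρ ⟨σ.1, σ.2.1⟩) hB
    · refine (extz_of_not_ok (fun σ => ρ ⟨σ.1, σ.2.1⟩) hB).trans ?_
      rw [hρ, Pi.sub_apply, Pi.sub_apply, ← Qop_annihilate_add hi ψ τ hB]
      ring

end Toggle

section Append

variable {N m : ℕ}

lemma fermions_append (τ : Config N) (p : Config m) :
    fermions (Fin.append τ p : Config (N + m)) = fermions τ + fermions p := by
  simp only [fermions, card_filter, Fin.sum_univ_add, Fin.append_left, Fin.append_right]

lemma sgn_append_castAdd (τ : Config N) (p : Config m) (j : Fin N) :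
    sgn (Fin.append τ p : Config (N + m)) (Fin.castAdd m j) = sgn τ j := by
  have h : ∀ k : Fin m, ¬ Fin.natAdd N k < Fin.castAdd m j := fun k hk => by
    have := Fin.lt_def.1 hk
    simp at this
    omega
  have h' : ∀ k : Fin N, Fin.castAdd m k < Fin.castAdd m j ↔ k < j := fun _ => Iff.rfl
  simp only [sgn, card_filter, Fin.sum_univ_add, h, h', Fin.append_left, false_and, if_false,
    sum_const_zero, add_zero]

lemma append_update_castAdd (τ : Config N) (p : Config m) (j : Fin N) (b : Bool) :
    update (Fin.append τ p : Config (N + m)) (Fin.castAdd m j) b =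
      Fin.append (update τ j b) p := by
  funext k
  refine Fin.addCases (fun k => ?_) (fun k => ?_) k
  · simp [update_apply]
  · rw [update_of_ne, Fin.append_right, Fin.append_right]
    intro h
    have := congrArg Fin.val h
    simp at this
    omega

lemma append_left_injective (p : Config m) :
    Injective fun τ : Config N => (Fin.append τ p : Config (N + m)) := by
  intro τ τ' h
  funext j
  simpa using congrFun h (Fin.castAdd m j)

/-- Appending a frozen block of sites shifts the grade of the cohomology by the fermion number
of the block. -/
theorem cohSpace_equiv_append {OKb : Config (N + m) → Prop} {OKs : Config N → Prop}
    (p : Config m) (hOK : ∀ σ, OKb σ ↔ ∃ τ, OKs τ ∧ σ = Fin.append τ p)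
    (hconn : {σ | OKb σ}.OrdConnected) (f : ℕ) :
    Nonempty (CohSpace (N + m) OKb (fun _ => True) (f + fermions p) ≃ₗ[ℂ]
      CohSpace N OKs (fun _ => True) f) := by
  have hs : ∀ τ, OKb (Fin.append τ p) ↔ OKs τ := by
    intro τ
    rw [hOK]
    constructor
    · rintro ⟨τ', h, h'⟩
      rwa [append_left_injective p h']
    · exact fun h => ⟨τ, h, rfl⟩
  have hinj : Injective fun τ : {τ // OKs τ} =>
      (⟨Fin.append τ.1 p, (hs _).2 τ.2⟩ : {σ // OKb σ}) := by
    intro τ τ' h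
    exact Subtype.ext (append_left_injective p (congrArg Subtype.val h))
  have hsurj : Surjective fun τ : {τ // OKs τ} =>
      (⟨Fin.append τ.1 p, (hs _).2 τ.2⟩ : {σ // OKb σ}) := by
    rintro ⟨σ, hσ⟩
    obtain ⟨τ, hτ, rfl⟩ := (hOK σ).1 hσ
    exact ⟨⟨τ, hτ⟩, rfl⟩
  let e := Equiv.ofBijective _ ⟨hinj, hsurj⟩
  let J : AState N OKs ≃ₗ[ℂ] AState (N + m) OKb := LinearEquiv.funCongrLeft ℂ ℂ e.symm
  have hJ : ∀ φ τ, J φ (e τ) = φ τ := fun φ τ => congrArg φ (e.symm_apply_apply τ)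
  have hJz : ∀ φ τ, extz (J φ) (Fin.append τ p) = extz φ τ := by
    intro φ τ
    by_cases h : OKs τ
    · rw [extz_of_ok _ ((hs τ).2 h), extz_of_ok _ h]
      exact hJ φ ⟨τ, h⟩
    · rw [extz_of_not_ok _ h, extz_of_not_ok _ fun h' => h ((hs τ).1 h')]
  have hval : ∀ (φ : AState N OKs) (P : ℕ → Prop),
      (∀ σ, P (fermions σ.1) → J φ σ = 0) ↔
        ∀ τ, P (fermions τ.1 + fermions p) → φ τ = 0 := by
    intro φ P
    rw [e.surjective.forall]
    refine forall_congr' fun τ => ?_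
    rw [hJ, ← fermions_append]
    rfl
  refine cohSpace_equiv_of_retract J.toLinearMap 0 (Qop_Qop hconn) J.injective ?_
    (fun φ => (hval φ fun n => n ≠ f + fermions p).trans ?_)
    (fun φ => (hval φ fun n => n + 1 ≠ f + fermions p).trans ?_)
    (fun _ _ => zero_mem _) (fun _ _ => by simp) (fun _ => rfl)
    (fun ψ => ⟨J.symm ψ, by simp⟩)
  · intro φ
    funext σ
    obtain ⟨τ, rfl⟩ := e.surjective σ
    rw [LinearEquiv.coe_coe, hJ, Qop_apply, Qop_apply]
    show (∑ j, if Fin.append τ.1 p j = true then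
      sgn (Fin.append τ.1 p : Config (N + m)) j *
        extz (J φ) (update (Fin.append τ.1 p) j false) else 0) = _
    rw [Fin.sum_univ_add]
    simp only [Fin.append_left, Fin.append_right, sgn_append_castAdd, append_update_castAdd,
      hJz]
    refine add_eq_left.2 (sum_eq_zero fun k _ => ?_)
    split_ifs with hk
    · rw [extz_of_not_ok, mul_zero]
      intro h
      obtain ⟨τ', -, h'⟩ := (hOK _).1 h
      have := congrFun h' (Fin.natAdd N k)
      simp [hk] at this
    · rfl
  · exact forall_congr' fun τ => by rw [Ne, add_left_inj]
  · refine forall_congr' fun τ => ?_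
    rw [add_right_comm, Ne, add_left_inj]

end Append

section OpenChain

variable {N : ℕ}

lemma extc_of_lt (σ : Config N) {t : ℕ} (h : t < N) : extc σ t = σ ⟨t, h⟩ := dif_pos h

lemma lt_of_extc {σ : Config N} {t : ℕ} (h : extc σ t = true) : t < N := by
  by_contra hn
  simp [extc, hn] at h

lemma extc_mono {σ τ : Config N} (hστ : σ ≤ τ) {t : ℕ} (h : extc σ t = true) :
    extc τ t = true := by
  have ht := lt_of_extc h
  rw [extc_of_lt _ ht] at h ⊢
  exact hστ _ h

lemma extc_update_true_self (σ : Config N) (i : Fin N) : extc (update σ i true) i = true := by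
  rw [extc_of_lt _ i.2]
  exact update_self ..

lemma extc_update_true_of_ne (σ : Config N) {i : Fin N} {t : ℕ} (h : t ≠ i) :
    extc (update σ i true) t = extc σ t := by
  unfold extc
  split_ifs
  · exact update_of_ne (fun h' => h (congrArg Fin.val h')) _ _
  · rfl

lemma OpenOK.of_le {ℓ c₁ c : ℕ} {σ τ : Config N} (hτ : OpenOK N ℓ c₁ c τ) (h : σ ≤ τ) :
    OpenOK N ℓ c₁ c σ :=
  ⟨fun a ha => hτ.1 a fun k hk => extc_mono h (ha k hk),
    fun ha => hτ.2.1 ⟨ha.1, fun k hk => extc_mono h (ha.2 k hk)⟩,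
    fun ha => hτ.2.2 ⟨ha.1, fun k hk => extc_mono h (ha.2 k hk)⟩⟩

/-- The pattern, read from the right end of the chain, with empty sites at the distances
`0`, `c + 1` and `ℓ + 2`. -/
def endPattern (ℓ c d : ℕ) : Bool := decide (d ≠ 0 ∧ d ≠ c + 1 ∧ d ≠ ℓ + 2)

/-- Allowed configurations of the open chain whose last `K` sites follow `endPattern`. -/
def PinnedOK (N ℓ c₁ c K : ℕ) (σ : Config N) : Prop :=
  OpenOK N ℓ c₁ c σ ∧ ∀ d < K, extc σ (N - 1 - d) = endPattern ℓ c d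

lemma pinnedOK_zero (ℓ c₁ c : ℕ) : PinnedOK N ℓ c₁ c 0 = OpenOK N ℓ c₁ c := by
  funext σ
  simp [PinnedOK]

lemma ordConnected_pinnedOK (ℓ c₁ c K : ℕ) : {σ | PinnedOK N ℓ c₁ c K σ}.OrdConnected := by
  refine ⟨fun σ hσ ρ hρ τ hτ => ⟨hρ.1.of_le hτ.2, fun d hd => ?_⟩⟩
  have h1 := hσ.2 d hd
  have h2 := hρ.2 d hd
  cases h : endPattern ℓ c d with
  | true => exact extc_mono hτ.1 (h1.trans h)
  | false =>
    by_contra hn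
    have := extc_mono hτ.2 (by simpa using hn)
    simp [h2, h] at this

/-- A pinned configuration is blocked at the first free site, at distance `K` from the right
end, exactly when the pinned block extends to distance `K'`: occupying the site at distance `K`
then creates a forbidden cluster covering the distances `s, …, K' - 1`. -/
lemma blocked_pinnedOK {ℓ c₁ c K K' s : ℕ} (hc : c ≤ ℓ) (hK'N : K' ≤ N)
    (hsK : s ≤ K) (hKK' : K < K') (hK : endPattern ℓ c K = false)
    (hbefore : ∀ d, s ≤ d → d < K → endPattern ℓ c d = true)
    (hafter : ∀ d, K < d → d < K' → endPattern ℓ c d = true)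
    (hs : K = 0 ∧ K' = c + 1 ∨ 0 < s ∧ endPattern ℓ c (s - 1) = false ∧ K' = s + ℓ + 1) :
    Blocked (PinnedOK N ℓ c₁ c K) ⟨N - 1 - K, by omega⟩ = PinnedOK N ℓ c₁ c K' := by
  funext σ
  set i : Fin N := ⟨N - 1 - K, by omega⟩
  have hiv : (i : ℕ) = N - 1 - K := rfl
  have hself := extc_update_true_self σ i
  have hne : ∀ t, t ≠ N - 1 - K → extc (update σ i true) t = extc σ t :=
    fun t ht => extc_update_true_of_ne σ ht
  rw [hiv] at hself
  apply propext
  constructor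
  · rintro ⟨⟨hσ, hpat⟩, hσi, hblock⟩
    have hnot : ¬ OpenOK N ℓ c₁ c (update σ i true) := fun h =>
      hblock ⟨h, fun d hd => by rw [hne _ (by omega), hpat d hd]⟩
    have hfull : ∀ d, K < d → d < K' → extc (update σ i true) (N - 1 - d) = true := by
      by_contra hcon
      refine hnot ⟨fun a ha => ?_, fun ha => ?_, fun ha => ?_⟩
      · have hmem : ∃ k ≤ ℓ, a + k = N - 1 - K := by
          by_contra hk
          push Not at hk
          exact hσ.1 a fun k hkl => by rw [← hne _ (hk k hkl), ha k hkl]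
        obtain ⟨k, hkl, hk⟩ := hmem
        have haN := lt_of_extc (ha ℓ le_rfl)
        have hlast : a + K' ≤ N := by
          rcases hs with ⟨_, _⟩ | ⟨hs0, hsp, hs'⟩
          · omega
          · by_contra hlt
            have h1 := ha (N - 1 - (s - 1) - a) (by omega)
            rw [show a + (N - 1 - (s - 1) - a) = N - 1 - (s - 1) by omega, hne _ (by omega),
              hpat _ (by omega), hsp] at h1
            exact absurd h1 (by simp)
        refine hcon fun d hd hd' => ?_
        have := ha (N - 1 - d - a) (by omega)
        rwa [show a + (N - 1 - d - a) = N - 1 - d by omega] at this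
      · have hmem : N - 1 - K ≤ c₁ := by
          by_contra hk
          exact hσ.2.1 ⟨ha.1, fun k hkl => by rw [← hne _ (by omega), ha.2 k hkl]⟩
        exact hcon fun d hd hd' => ha.2 _ (by omega)
      · rcases hs with ⟨_, hs'⟩ | ⟨hs0, -, -⟩
        · exact hcon fun d hd hd' => ha.2 _ (by omega)
        · have h1 := ha.2 0 (Nat.zero_le _)
          rw [hne _ (by omega), hpat 0 (by omega)] at h1
          simp [endPattern] at h1
    refine ⟨hσ, fun d hd => ?_⟩
    rcases lt_trichotomy d K with h | rfl | h
    · exact hpat d h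
    · rw [hK, ← hσi]
      exact extc_of_lt _ _
    · rw [← hne _ (by omega), hfull d h hd, hafter d h hd]
  · rintro ⟨hσ, hpat⟩
    refine ⟨⟨hσ, fun d hd => hpat d (hd.trans hKK')⟩, ?_, fun hblock => ?_⟩
    · rw [← hK, ← hpat K hKK']
      exact (extc_of_lt _ _).symm
    · have hfull : ∀ d, s ≤ d → d < K' → extc (update σ i true) (N - 1 - d) = true := by
        intro d hsd hd
        rcases lt_trichotomy d K with h | rfl | h
        · rw [hne _ (by omega), hpat d hd, hbefore d hsd h]
        · exact hself
        · rw [hne _ (by omega), hpat d hd, hafter d h hd]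
      rcases hs with ⟨hK0, hs'⟩ | ⟨hs0, -, hs'⟩
      · exact hblock.1.2.2 ⟨by omega, fun k hk => hfull k (by omega) (by omega)⟩
      · refine hblock.1.1 (N - K') fun k hk => ?_
        rw [show N - K' + k = N - 1 - (K' - 1 - k) by omega]
        exact hfull _ (by omega) (by omega)

lemma PinnedOK.update_false {ℓ c₁ c K : ℕ} {i : Fin N} (hi : (i : ℕ) + K < N)
    {σ : Config N} (hσ : PinnedOK N ℓ c₁ c K σ) : PinnedOK N ℓ c₁ c K (update σ i false) := by
  refine ⟨hσ.1.of_le (update_false_le _ _), fun d hd => ?_⟩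
  rw [← hσ.2 d hd, extc_of_lt _ (by omega), extc_of_lt _ (by omega), update_of_ne]
  intro h
  have := congrArg Fin.val h
  simp at this
  omega

/-- Extending the pinned block as in `blocked_pinnedOK` does not change the cohomology. -/
lemma cohSpace_equiv_pinnedOK {ℓ c₁ c K K' s : ℕ} (hc : c ≤ ℓ) (hK'N : K' ≤ N)
    (hsK : s ≤ K) (hKK' : K < K') (hK : endPattern ℓ c K = false)
    (hbefore : ∀ d, s ≤ d → d < K → endPattern ℓ c d = true)
    (hafter : ∀ d, K < d → d < K' → endPattern ℓ c d = true)
    (hs : K = 0 ∧ K' = c + 1 ∨ 0 < s ∧ endPattern ℓ c (s - 1) = false ∧ K' = s + ℓ + 1)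
    (f : ℕ) :
    Nonempty (CohSpace N (PinnedOK N ℓ c₁ c K) (fun _ => True) f ≃ₗ[ℂ]
      CohSpace N (PinnedOK N ℓ c₁ c K') (fun _ => True) f) := by
  rw [← blocked_pinnedOK (c₁ := c₁) hc hK'N hsK hKK' hK hbefore hafter hs]
  exact cohSpace_equiv_blocked (ordConnected_pinnedOK ..)
    (fun σ hσ => hσ.update_false (by simp only; omega)) f

lemma cohSpace_equiv_pinnedOK_edge {ℓ c₁ c : ℕ} (hc : c ≤ ℓ) (hN : ℓ < N) (f : ℕ) :
    Nonempty (CohSpace N (OpenOK N ℓ c₁ c) (fun _ => True) f ≃ₗ[ℂ]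
      CohSpace N (PinnedOK N ℓ c₁ c (c + 1)) (fun _ => True) f) := by
  rw [← pinnedOK_zero]
  refine cohSpace_equiv_pinnedOK (s := 0) hc (by omega) le_rfl (by omega)
    (by simp [endPattern]) (fun d _ _ => by omega) (fun d _ _ => ?_) (Or.inl ⟨rfl, rfl⟩) f
  simp only [endPattern, decide_eq_true_eq]
  omega

lemma cohSpace_equiv_pinnedOK_full {ℓ c₁ c : ℕ} (hc : c ≤ ℓ) (hN : ℓ + c + 3 ≤ N) (f : ℕ) :
    Nonempty (CohSpace N (OpenOK N ℓ c₁ c) (fun _ => True) f ≃ₗ[ℂ]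
      CohSpace N (PinnedOK N ℓ c₁ c (ℓ + c + 3)) (fun _ => True) f) := by
  obtain ⟨e₁⟩ := cohSpace_equiv_pinnedOK_edge (c₁ := c₁) hc (by omega : ℓ < N) f
  obtain ⟨e₂⟩ : Nonempty (CohSpace N (PinnedOK N ℓ c₁ c (c + 1)) (fun _ => True) f ≃ₗ[ℂ]
      CohSpace N (PinnedOK N ℓ c₁ c (ℓ + 2)) (fun _ => True) f) := by
    refine cohSpace_equiv_pinnedOK (s := 1) hc (by omega) (by omega) (by omega)
      (by simp [endPattern]) (fun d _ _ => ?_) (fun d _ _ => ?_)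
      (Or.inr ⟨one_pos, by simp [endPattern], by omega⟩) f <;>
    · simp only [endPattern, decide_eq_true_eq]
      omega
  obtain ⟨e₃⟩ : Nonempty (CohSpace N (PinnedOK N ℓ c₁ c (ℓ + 2)) (fun _ => True) f ≃ₗ[ℂ]
      CohSpace N (PinnedOK N ℓ c₁ c (ℓ + c + 3)) (fun _ => True) f) := by
    refine cohSpace_equiv_pinnedOK (s := c + 2) hc (by omega) (by omega) (by omega)
      (by simp [endPattern]) (fun d _ _ => ?_) (fun d _ _ => ?_)
      (Or.inr ⟨by omega, by simp [endPattern], by omega⟩) f <;>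
    · simp only [endPattern, decide_eq_true_eq]
      omega
  exact ⟨(e₁.trans e₂).trans e₃⟩

/-- The last `ℓ + 2` sites of `endPattern`. -/
def endBlock (ℓ c : ℕ) : Config (ℓ + 2) := fun j => endPattern ℓ c (ℓ + 1 - j)

lemma fermions_endBlock {ℓ c : ℕ} (hc : c ≤ ℓ) : fermions (endBlock ℓ c) = ℓ := by
  have h : (univ.filter fun j => endBlock ℓ c j = true) =
      (univ.erase (Fin.last (ℓ + 1))).erase ⟨ℓ - c, by omega⟩ := by
    ext j
    simp only [endBlock, endPattern, decide_eq_true_eq, mem_filter, mem_univ, true_and,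
      mem_erase, and_true, ne_eq, Fin.ext_iff, Fin.val_last]
    omega
  rw [fermions, h, card_erase_of_mem, card_erase_of_mem (mem_univ _), card_univ,
    Fintype.card_fin]
  · omega
  · simp only [mem_erase, mem_univ, and_true, ne_eq, Fin.ext_iff, Fin.val_last]
    omega

lemma extc_append_of_lt {m : ℕ} (τ : Config N) (p : Config m) {t : ℕ} (h : t < N) :
    extc (Fin.append τ p : Config (N + m)) t = extc τ t := by
  rw [extc_of_lt _ h, extc_of_lt _ (by omega)]
  exact Fin.append_left τ p ⟨t, h⟩

lemma extc_append_endBlock (ℓ c : ℕ) (τ : Config N) {d : ℕ} (h : d < ℓ + 2) :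
    extc (Fin.append τ (endBlock ℓ c) : Config (N + (ℓ + 2))) (N + (ℓ + 2) - 1 - d) =
      endPattern ℓ c d := by
  rw [extc_of_lt _ (by omega)]
  have := Fin.append_right τ (endBlock ℓ c) ⟨ℓ + 1 - d, by omega⟩
  convert this using 2
  · ext
    simp only [Fin.val_natAdd]
    omega
  · simp only [endBlock]
    congr 1
    omega

/-- The pinned configurations of the long chain are those of the short chain followed by a
fixed block. -/
lemma pinnedOK_iff_append {ℓ c₁ c : ℕ} (hc₁ : c₁ ≤ ℓ) (hc : c ≤ ℓ) (hN : ℓ < N)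
    (σ : Config (N + (ℓ + 2))) :
    PinnedOK (N + (ℓ + 2)) ℓ c₁ c (ℓ + c + 3) σ ↔
      ∃ τ : Config N, PinnedOK N ℓ c₁ c (c + 1) τ ∧ σ = Fin.append τ (endBlock ℓ c) := by
  have hpat : ∀ d ≤ c, endPattern ℓ c (ℓ + 2 + d) = endPattern ℓ c d := by
    intro d hd
    simp only [endPattern, decide_eq_decide]
    omega
  have hpos : ∀ d, d < N → N + (ℓ + 2) - 1 - (ℓ + 2 + d) = N - 1 - d := fun d hd => by omega
  constructor
  · intro hσ
    have happ : σ = Fin.append (fun j => σ (Fin.castAdd _ j)) (endBlock ℓ c) := by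
      funext j
      refine Fin.addCases (fun k => ?_) (fun k => ?_) j
      · rw [Fin.append_left]
      · rw [Fin.append_right, endBlock, ← hσ.2 _ (by omega), extc_of_lt _ (by omega)]
        congr 1
        ext
        simp only [Fin.val_natAdd]
        omega
    generalize (fun j => σ (Fin.castAdd _ j) : Config N) = τ at happ
    subst happ
    have hlt : ∀ {t}, extc τ t = true →
        extc (Fin.append τ (endBlock ℓ c) : Config (N + (ℓ + 2))) t = true := fun h => by
      rw [extc_append_of_lt _ _ (lt_of_extc h), h]
    have hend : ∀ d < c + 1, extc τ (N - 1 - d) = endPattern ℓ c d := by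
      intro d hd
      rw [← hpat d (by omega), ← hσ.2 _ (by omega), hpos d (by omega),
        extc_append_of_lt _ _ (by omega)]
    refine ⟨τ, ⟨⟨fun a ha => hσ.1.1 a fun k hk => hlt (ha k hk),
      fun ha => hσ.1.2.1 ⟨by omega, fun k hk => hlt (ha.2 k hk)⟩, fun ha => ?_⟩, hend⟩, rfl⟩
    have h := ha.2 0 (Nat.zero_le _)
    rw [hend 0 (by omega)] at h
    simp [endPattern] at h
  · rintro ⟨τ, hτ, rfl⟩
    have hend : ∀ d < ℓ + c + 3, extc (Fin.append τ (endBlock ℓ c) : Config (N + (ℓ + 2)))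
        (N + (ℓ + 2) - 1 - d) = endPattern ℓ c d := by
      intro d hd
      by_cases h : d < ℓ + 2
      · exact extc_append_endBlock ℓ c τ h
      · obtain ⟨e, rfl⟩ := Nat.exists_eq_add_of_le (not_lt.1 h)
        rw [hpat e (by omega), hpos e (by omega), extc_append_of_lt _ _ (by omega),
          hτ.2 e (by omega)]
    refine ⟨⟨fun a ha => ?_, fun ha => ?_, fun ha => ?_⟩, hend⟩
    · have haN := lt_of_extc (ha ℓ le_rfl)
      have hgap : ∀ d < ℓ + c + 3, endPattern ℓ c d = false → a ≤ N + (ℓ + 2) - 1 - d →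
          a + ℓ < N + (ℓ + 2) - 1 - d := by
        intro d hd hdp had
        by_contra hn
        have h := ha (N + (ℓ + 2) - 1 - d - a) (by omega)
        rw [show a + (N + (ℓ + 2) - 1 - d - a) = N + (ℓ + 2) - 1 - d by omega, hend d hd,
          hdp] at h
        exact absurd h (by simp)
      have h1 := hgap 0 (by omega) (by simp [endPattern]) (by omega)
      have h2 := hgap (c + 1) (by omega) (by simp [endPattern]) (by omega)
      have h3 := hgap (ℓ + 2) (by omega) (by simp [endPattern]) (by omega)
      exact hτ.1.1 a fun k hk => by rw [← extc_append_of_lt τ (endBlock ℓ c) (by omega), ha k hk]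
    · exact hτ.1.2.1 ⟨by omega, fun k hk => by
        rw [← extc_append_of_lt τ (endBlock ℓ c) (by omega), ha.2 k hk]⟩
    · have h := ha.2 0 (Nat.zero_le _)
      rw [hend 0 (by omega)] at h
      simp [endPattern] at h

end OpenChain

/-- Cut (and paste), special boundary conditions: for the `M_ℓ` model on the open chain
of `N = Ñ + (ℓ+2) > 2ℓ+2` sites with special boundary conditions `s = (c₁, cN)`,
the cohomology `H_Q^f` at any grade `f ≥ ℓ` is isomorphic to the cohomology
`H_Q^{f-ℓ}` of the open chain of `Ñ` sites with the same special boundary conditions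
`(c₁, cN)`; in particular their dimensions are equal. -/
theorem cut_and_paste_special (ℓ Nt : ℕ) (hℓ : 1 ≤ ℓ) (hNt : ℓ < Nt)
    (c₁ cN : ℕ) (hc₁ : c₁ ≤ ℓ) (hcN : cN ≤ ℓ) (f : ℕ) (hf : ℓ ≤ f) :
    Nonempty
      (CohSpace (Nt + (ℓ + 2)) (OpenOK (Nt + (ℓ + 2)) ℓ c₁ cN) (fun _ => True) f ≃ₗ[ℂ]
        CohSpace Nt (OpenOK Nt ℓ c₁ cN) (fun _ => True) (f - ℓ)) ∧
    cohDim (Nt + (ℓ + 2)) (OpenOK (Nt + (ℓ + 2)) ℓ c₁ cN) (fun _ => True) f =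
      cohDim Nt (OpenOK Nt ℓ c₁ cN) (fun _ => True) (f - ℓ) := by
  obtain ⟨g, rfl⟩ := Nat.exists_eq_add_of_le' hf
  rw [Nat.add_sub_cancel]
  obtain ⟨e₁⟩ := cohSpace_equiv_pinnedOK_full (N := Nt + (ℓ + 2)) (c₁ := c₁) hcN (by omega)
    (g + ℓ)
  obtain ⟨e₂⟩ := cohSpace_equiv_append (endBlock ℓ cN) (pinnedOK_iff_append hc₁ hcN hNt)
    (ordConnected_pinnedOK ..) g
  rw [fermions_endBlock hcN] at e₂
  obtain ⟨e₃⟩ := cohSpace_equiv_pinnedOK_edge (c₁ := c₁) hcN hNt g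
  have e := (e₁.trans e₂).trans e₃.symm
  exact ⟨⟨e⟩, e.finrank_eq⟩

end
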